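/- arXiv:math/0610055 — 5 statements merged into one kernel-verified Lean document; each statement's English description precedes it below -/
import Mathlib

section
/- Let X ⊆ ℝⁿ be an open set and let 𝒩 be a continuous round cone family on X. Every point x ∈ X admits a base of neighborhoods formed by 𝒩-lenses: for every neighborhood Ω of x in X there exists an 𝒩-lens Z with x ∈ interior(Z) and Z ⊆ Ω. -/
open Set

noncomputable section

/-- `ℝⁿ`. -/
abbrev Euc (n : ℕ) : Type := EuclideanSpace ℝ (Fin n)

/-- A round cone in `ℝⁿ`: a closed convex set, stable under nonnegative scalar
multiplication, with nonempty interior, satisfying `N ∩ (-N) = {0}`. -/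
def IsRoundCone {n : ℕ} (N : Set (Euc n)) : Prop :=
  IsClosed N ∧ Convex ℝ N ∧ (∀ c : ℝ, 0 ≤ c → ∀ v ∈ N, c • v ∈ N) ∧
    (interior N).Nonempty ∧ N ∩ (-N) = {0}

/-- The fiber `𝒩ₓ` of a cone family at a point `x`. -/
def coneFiber {n : ℕ} (𝒩 : Set (Euc n × Euc n)) (x : Euc n) : Set (Euc n) :=
  {v | (x, v) ∈ 𝒩}

/-- Restriction `𝒩_V := 𝒩 ∩ (V × ℝⁿ)` of a cone family to a subset `V`. -/
def coneRestrict {n : ℕ} (𝒩 : Set (Euc n × Euc n)) (V : Set (Euc n)) :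
    Set (Euc n × Euc n) :=
  𝒩 ∩ (V ×ˢ (univ : Set (Euc n)))

/-- A continuous round cone family on `X ⊆ ℝⁿ`. -/
structure IsConeFam {n : ℕ} (X : Set (Euc n)) (𝒩 : Set (Euc n × Euc n)) : Prop where
  subset : 𝒩 ⊆ X ×ˢ (univ : Set (Euc n))
  closed : ∃ C : Set (Euc n × Euc n), IsClosed C ∧ 𝒩 = C ∩ (X ×ˢ (univ : Set (Euc n)))
  cone : ∀ x ∈ X, IsRoundCone (coneFiber 𝒩 x)
  lsc : ∀ x ∈ X, ∀ v ∈ interior (coneFiber 𝒩 x),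
    ∃ V : Set (Euc n), IsOpen V ∧ x ∈ V ∧ V ⊆ X ∧ ∀ y ∈ V, v ∈ interior (coneFiber 𝒩 y)

/-- A C¹ arc in `X`, given by `γ` together with its derivative `γ'` on `[0,1]`. -/
structure IsC1ArcIn {n : ℕ} (X : Set (Euc n)) (γ γ' : ℝ → Euc n) : Prop where
  maps : ∀ t ∈ Icc (0:ℝ) 1, γ t ∈ X
  deriv : ∀ t ∈ Icc (0:ℝ) 1, HasDerivWithinAt γ (γ' t) (Icc (0:ℝ) 1) t
  cont : ContinuousOn γ' (Icc (0:ℝ) 1)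

/-- `P ⊆ X` is `𝒩`-invariant: every C¹ arc starting in `P` whose velocity lies in
`𝒩_{γ(t)} \ {0}` stays in `P`. -/
def NInvariant {n : ℕ} (X : Set (Euc n)) (𝒩 : Set (Euc n × Euc n))
    (P : Set (Euc n)) : Prop :=
  ∀ γ γ' : ℝ → Euc n, IsC1ArcIn X γ γ' → γ 0 ∈ P →
    (∀ t ∈ Icc (0:ℝ) 1, γ' t ∈ coneFiber 𝒩 (γ t) \ {0}) →
    ∀ t ∈ Icc (0:ℝ) 1, γ t ∈ P

/-- `𝒩`-open subsets of `X`: open and `𝒩`-invariant. -/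
def NOpen {n : ℕ} (X : Set (Euc n)) (𝒩 : Set (Euc n × Euc n)) (U : Set (Euc n)) : Prop :=
  U ⊆ X ∧ IsOpen U ∧ NInvariant X 𝒩 U

/-- An `𝒩`-smooth function on `V`: a C¹ function with `df_x(τ) < 0` for all
`τ ∈ 𝒩ₓ \ {0}`, `x ∈ V`. -/
def NSmoothOn {n : ℕ} (𝒩 : Set (Euc n × Euc n)) (f : Euc n → ℝ) (V : Set (Euc n)) : Prop :=
  ∃ df : Euc n → (Euc n →L[ℝ] ℝ), ContinuousOn df V ∧ (∀ x ∈ V, HasFDerivAt f (df x) x) ∧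
    ∀ x ∈ V, ∀ τ ∈ coneFiber 𝒩 x \ {0}, df x τ < 0

/-- `P` is `𝒩`-small: some open neighborhood of `P` in `X` admits an `𝒩`-smooth function. -/
def NSmall {n : ℕ} (X : Set (Euc n)) (𝒩 : Set (Euc n × Euc n)) (P : Set (Euc n)) : Prop :=
  ∃ (W : Set (Euc n)) (f : Euc n → ℝ), IsOpen W ∧ P ⊆ W ∧ W ⊆ X ∧ NSmoothOn 𝒩 f W

/-- `Z ⊆ X` is `𝒩`-special: every point of the closure of `Z` in `X` has an open
neighborhood `V ⊆ X` on which, for some continuous round cone family `𝒩'` with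
`𝒩_V ⋐ 𝒩'`, the set `Z ∩ V` is locally closed in the `𝒩'`-topology of `V`. -/
def NSpecial {n : ℕ} (X : Set (Euc n)) (𝒩 : Set (Euc n × Euc n)) (Z : Set (Euc n)) : Prop :=
  Z ⊆ X ∧ ∀ x ∈ closure Z ∩ X, ∃ (V : Set (Euc n)) (𝒩' : Set (Euc n × Euc n)),
    IsOpen V ∧ x ∈ V ∧ V ⊆ X ∧ IsConeFam V 𝒩' ∧
    (∀ y ∈ V, coneFiber (coneRestrict 𝒩 V) y \ {0} ⊆ interior (coneFiber 𝒩' y)) ∧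
    ∃ U₁ U₂ : Set (Euc n), NOpen V 𝒩' U₁ ∧ NOpen V 𝒩' U₂ ∧ Z ∩ V = U₁ \ U₂

/-- An `𝒩`-lens: an `𝒩`-special subset whose closure in `X` is compact and `𝒩`-small. -/
def NLens {n : ℕ} (X : Set (Euc n)) (𝒩 : Set (Euc n × Euc n)) (Z : Set (Euc n)) : Prop :=
  NSpecial X 𝒩 Z ∧ IsCompact (closure Z ∩ X) ∧ NSmall X 𝒩 (closure Z ∩ X)

/-- A (finite) partition of a subset `S`: finitely many pairwise disjoint nonempty
subsets with union `S`. -/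
def IsPartitionOf {α : Type*} (S : Set α) (Ps : Set (Set α)) : Prop :=
  Ps.Finite ∧ (∀ A ∈ Ps, A.Nonempty) ∧
    (∀ A ∈ Ps, ∀ B ∈ Ps, A ≠ B → Disjoint A B) ∧ ⋃₀ Ps = S

/-- A partition of `S` comes from a closed filtration: there is a chain
`∅ = F₀ ⊆ … ⊆ F_m = S` of subsets closed in `S` whose nonempty successive
differences are exactly the members of the partition. -/
def ComesFromClosedFiltration {α : Type*} [TopologicalSpace α] (S : Set α)
    (Ps : Set (Set α)) : Prop :=
  ∃ (m : ℕ) (F : ℕ → Set α), F 0 = ∅ ∧ F m = S ∧ (∀ i < m, F i ⊆ F (i + 1)) ∧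
    (∀ i ≤ m, ∃ C : Set α, IsClosed C ∧ F i = C ∩ S) ∧
    Ps = {A | A.Nonempty ∧ ∃ i, 1 ≤ i ∧ i ≤ m ∧ A = F i \ F (i - 1)}

/-- An `𝒩`-special partition of an `𝒩`-lens `Z`: it comes from a closed filtration
of `Z` and each member is an `𝒩`-lens. -/
def NSpecialPartition {n : ℕ} (X : Set (Euc n)) (𝒩 : Set (Euc n × Euc n))
    (Z : Set (Euc n)) (Ps : Set (Set (Euc n))) : Prop :=
  IsPartitionOf Z Ps ∧ ComesFromClosedFiltration Z Ps ∧ ∀ A ∈ Ps, NLens X 𝒩 A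

/-- `𝒩`-constructible subsets: the smallest collection containing all `𝒩`-lenses and
stable under finite unions, intersections and differences. -/
inductive NConstructible {n : ℕ} (X : Set (Euc n)) (𝒩 : Set (Euc n × Euc n)) :
    Set (Euc n) → Prop
  | lens (Z : Set (Euc n)) : NLens X 𝒩 Z → NConstructible X 𝒩 Z
  | union (A B : Set (Euc n)) :
      NConstructible X 𝒩 A → NConstructible X 𝒩 B → NConstructible X 𝒩 (A ∪ B)
  | inter (A B : Set (Euc n)) :
      NConstructible X 𝒩 A → NConstructible X 𝒩 B → NConstructible X 𝒩 (A ∩ B)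
  | diff (A B : Set (Euc n)) :
      NConstructible X 𝒩 A → NConstructible X 𝒩 B → NConstructible X 𝒩 (A \ B)

/-- Membership in `Par^≺(Y)`: a partition of `Y` all of whose members are `𝒩`-lenses. -/
def ParPrec {n : ℕ} (X : Set (Euc n)) (𝒩 : Set (Euc n × Euc n)) (Y : Set (Euc n))
    (Ps : Set (Set (Euc n))) : Prop :=
  IsPartitionOf Y Ps ∧ ∀ A ∈ Ps, NLens X 𝒩 A

/-- The relation `⪯` on `Par^≺(Y)`: `Ps ⪯ Qs` if `Qs` refines `Ps` and for each member
`A` of `Ps` the members of `Qs` contained in `A` form an `𝒩`-special partition of `A`. -/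
def PrecRel {n : ℕ} (X : Set (Euc n)) (𝒩 : Set (Euc n × Euc n))
    (Ps Qs : Set (Set (Euc n))) : Prop :=
  (∀ B ∈ Qs, ∃ A ∈ Ps, B ⊆ A) ∧
    ∀ A ∈ Ps, NSpecialPartition X 𝒩 A {B | B ∈ Qs ∧ B ⊆ A}

open Topology

section Cones

variable {E : Type*} [NormedAddCommGroup E] [NormedSpace ℝ E]

/-- A set is a closed convex cone: closed and containing `0`, all sums and nonnegative multiples
of its elements. -/
structure IsClosedConvexCone (N : Set E) : Prop where
  isClosed : IsClosed N
  zero_mem : (0 : E) ∈ N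
  smul_mem : ∀ c : ℝ, 0 ≤ c → ∀ v ∈ N, c • v ∈ N
  add_mem : ∀ u ∈ N, ∀ v ∈ N, u + v ∈ N

theorem IsClosedConvexCone.convex {N : Set E} (hN : IsClosedConvexCone N) : Convex ℝ N :=
  fun u hu v hv a b ha hb _ =>
    hN.add_mem _ (hN.smul_mem a ha u hu) _ (hN.smul_mem b hb v hv)

/-- A point outside a closed convex cone is separated from it by a functional which is
nonnegative on the cone. -/
theorem IsClosedConvexCone.exists_separating {N : Set E} (hN : IsClosedConvexCone N) {x : E}
    (hx : x ∉ N) : ∃ f : E →L[ℝ] ℝ, (∀ v ∈ N, 0 ≤ f v) ∧ f x < 0 := by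
  obtain ⟨f, u, hfx, hf⟩ := geometric_hahn_banach_point_closed hN.convex hN.isClosed hx
  have hu : u < 0 := by simpa using hf 0 hN.zero_mem
  refine ⟨f, fun v hv => ?_, hfx.trans hu⟩
  by_contra! hlt
  have h := hf _ (hN.smul_mem (u / f v) (div_nonneg_of_nonpos hu.le hlt.le) v hv)
  rw [map_smul, smul_eq_mul, div_mul_cancel₀ _ hlt.ne] at h
  exact lt_irrefl _ h

/-- A pointed closed convex cone in finite dimension admits a functional dominating the norm
on the cone. -/
theorem IsClosedConvexCone.exists_norm_le [FiniteDimensional ℝ E] {N : Set E}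
    (hN : IsClosedConvexCone N) (hp : ∀ v ∈ N, -v ∈ N → v = 0) :
    ∃ f : E →L[ℝ] ℝ, ∀ v ∈ N, ‖v‖ ≤ f v := by
  have : ProperSpace E := FiniteDimensional.proper_real E
  have key : ∃ f : E →L[ℝ] ℝ, (∀ v ∈ N, 0 ≤ f v) ∧
      ∀ v ∈ Metric.sphere (0 : E) 1, v ∈ N → 1 ≤ f v := by
    refine (isCompact_sphere (0 : E) 1).induction_on
      (p := fun s => ∃ f : E →L[ℝ] ℝ, (∀ v ∈ N, 0 ≤ f v) ∧ ∀ v ∈ s, v ∈ N → 1 ≤ f v)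
      ⟨0, by simp, by simp⟩ ?_ ?_ ?_
    · rintro s t hst ⟨f, h0, h1⟩
      exact ⟨f, h0, fun v hv => h1 v (hst hv)⟩
    · rintro s t ⟨f, hf0, hf1⟩ ⟨g, hg0, hg1⟩
      refine ⟨f + g, fun v hv => add_nonneg (hf0 v hv) (hg0 v hv), ?_⟩
      rintro v (hv | hv) hvN
      · exact le_add_of_le_of_nonneg (hf1 v hv hvN) (hg0 v hvN)
      · exact le_add_of_nonneg_of_le (hf0 v hvN) (hg1 v hv hvN)
    · intro u hu
      have hu0 : u ≠ 0 := ne_zero_of_mem_unit_sphere ⟨u, hu⟩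
      by_cases huN : u ∈ N
      · obtain ⟨f, hf0, hfu⟩ := hN.exists_separating (fun h => hu0 (hp u huN h))
        rw [map_neg, neg_lt_zero] at hfu
        have hev : {v | f u / 2 < f v} ∈ 𝓝 u :=
          (isOpen_lt continuous_const f.continuous).mem_nhds (half_lt_self hfu)
        refine ⟨_, mem_nhdsWithin_of_mem_nhds hev, (2 / f u) • f, fun v hv => ?_,
          fun v hv _ => ?_⟩
        · exact mul_nonneg (by positivity) (hf0 v hv)
        · have hv' : f u / 2 < f v := hv
          have : 1 = 2 / f u * (f u / 2) := by field_simp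
          rw [this]
          exact mul_le_mul_of_nonneg_left hv'.le (by positivity)
      · exact ⟨Nᶜ, mem_nhdsWithin_of_mem_nhds (hN.isClosed.isOpen_compl.mem_nhds huN), 0,
          by simp, fun v hv hvN => absurd hvN hv⟩
  obtain ⟨f, -, hf⟩ := key
  refine ⟨f, fun v hv => ?_⟩
  rcases eq_or_ne v 0 with rfl | hv0
  · simp
  have hpos : 0 < ‖v‖ := norm_pos_iff.2 hv0
  have h := hf (‖v‖⁻¹ • v) (by simp [norm_smul, hpos.ne'])
    (hN.smul_mem _ (by positivity) v hv)
  rw [map_smul, smul_eq_mul, inv_mul_eq_div, one_le_div hpos] at h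
  exact h

/-- The points whose distance to `N` is at most `f`. -/
def conicThickening (N : Set E) (f : E →L[ℝ] ℝ) : Set E :=
  {v | Metric.infDist v N ≤ f v}

theorem subset_interior_conicThickening {N : Set E} {f : E →L[ℝ] ℝ} :
    {v | Metric.infDist v N < f v} ⊆ interior (conicThickening N f) :=
  interior_maximal (ofPred_subset_ofPred.2 fun _ hv => hv.le)
    (isOpen_lt (Metric.continuous_infDist_pt N) f.continuous)

theorem nonneg_of_mem_conicThickening {N : Set E} {f : E →L[ℝ] ℝ} {v : E}
    (hv : v ∈ conicThickening N f) : 0 ≤ f v :=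
  Metric.infDist_nonneg.trans hv

theorem IsClosedConvexCone.mem_conicThickening_iff [ProperSpace E] {N : Set E}
    (hN : IsClosedConvexCone N) {f : E →L[ℝ] ℝ} {v : E} :
    v ∈ conicThickening N f ↔ ∃ u ∈ N, ‖v - u‖ ≤ f v := by
  constructor
  · intro hv
    obtain ⟨u, hu, h⟩ := hN.isClosed.exists_infDist_eq_dist ⟨0, hN.zero_mem⟩ v
    refine ⟨u, hu, ?_⟩
    rw [← dist_eq_norm, ← h]
    exact hv
  · rintro ⟨u, hu, h⟩
    exact (Metric.infDist_le_dist_of_mem hu).trans (by rwa [dist_eq_norm])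

theorem IsClosedConvexCone.conicThickening [ProperSpace E] {N : Set E}
    (hN : IsClosedConvexCone N) (f : E →L[ℝ] ℝ) :
    IsClosedConvexCone (conicThickening N f) where
  isClosed := isClosed_le (Metric.continuous_infDist_pt N) f.continuous
  zero_mem := hN.mem_conicThickening_iff.2 ⟨0, hN.zero_mem, by simp⟩
  smul_mem := by
    intro c hc v hv
    obtain ⟨u, hu, h⟩ := hN.mem_conicThickening_iff.1 hv
    refine hN.mem_conicThickening_iff.2 ⟨c • u, hN.smul_mem c hc u hu, ?_⟩
    rw [← smul_sub, norm_smul, Real.norm_of_nonneg hc, map_smul]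
    exact mul_le_mul_of_nonneg_left h hc
  add_mem := by
    intro v hv w hw
    obtain ⟨a, ha, h₁⟩ := hN.mem_conicThickening_iff.1 hv
    obtain ⟨b, hb, h₂⟩ := hN.mem_conicThickening_iff.1 hw
    refine hN.mem_conicThickening_iff.2 ⟨a + b, hN.add_mem a ha b hb, ?_⟩
    rw [add_sub_add_comm, map_add]
    exact norm_add_le_of_le h₁ h₂

/-- If `f` dominates the norm on `N`, a multiple of `f` dominates it on the thickening. -/
theorem IsClosedConvexCone.norm_le_of_mem_conicThickening [ProperSpace E] {N : Set E}
    (hN : IsClosedConvexCone N) {f : E →L[ℝ] ℝ} (hf : ∀ v ∈ N, ‖v‖ ≤ f v) {v : E}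
    (hv : v ∈ _root_.conicThickening N f) : ‖v‖ ≤ (‖f‖ + 2) * f v := by
  obtain ⟨u, hu, h⟩ := hN.mem_conicThickening_iff.1 hv
  have h₁ : ‖v‖ ≤ ‖v - u‖ + ‖u‖ := norm_le_norm_sub_add v u
  have h₂ : f u - f v ≤ ‖f‖ * ‖v - u‖ := by
    rw [← map_sub, norm_sub_rev]
    exact (le_abs_self _).trans (f.le_opNorm _)
  have h₃ : ‖f‖ * ‖v - u‖ ≤ ‖f‖ * f v := mul_le_mul_of_nonneg_left h (norm_nonneg f)
  have h₄ := hf u hu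
  linarith

theorem IsClosedConvexCone.add_mem_interior {K : Set E} (hK : IsClosedConvexCone K) {u v : E}
    (hu : u ∈ interior K) (hv : v ∈ K) : u + v ∈ interior K := by
  have hsub : (fun w => w - v) ⁻¹' interior K ⊆ K := fun w hw => by
    simpa using hK.add_mem _ (interior_subset hw) v hv
  exact interior_maximal hsub
    (isOpen_interior.preimage (continuous_id.sub continuous_const)) (by simpa using hu)

/-- A curve with velocities in a closed convex cone has its displacements in that cone. -/
theorem IsClosedConvexCone.sub_mem_of_hasDerivWithinAt {K : Set E} (hK : IsClosedConvexCone K)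
    {γ γ' : ℝ → E}
    (hγ : ∀ t ∈ Icc (0 : ℝ) 1, HasDerivWithinAt γ (γ' t) (Icc (0 : ℝ) 1) t)
    (hγ' : ∀ t ∈ Icc (0 : ℝ) 1, γ' t ∈ K) {t : ℝ} (ht : t ∈ Icc (0 : ℝ) 1) :
    γ t - γ 0 ∈ K := by
  by_contra h
  obtain ⟨f, hf, hlt⟩ := hK.exists_separating h
  have hd : ∀ s ∈ Icc (0 : ℝ) 1,
      HasDerivWithinAt (fun s => f (γ s)) (f (γ' s)) (Icc (0 : ℝ) 1) s := fun s hs =>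
    f.hasFDerivAt.comp_hasDerivWithinAt s (hγ s hs)
  have hmono : MonotoneOn (fun s => f (γ s)) (Icc (0 : ℝ) 1) :=
    monotoneOn_of_hasDerivWithinAt_nonneg (convex_Icc 0 1)
      (fun s hs => (hd s hs).continuousWithinAt)
      (fun s hs => (hd s (interior_subset hs)).mono interior_subset)
      (fun s hs => hf _ (hγ' s (interior_subset hs)))
  have := hmono (left_mem_Icc.2 zero_le_one) ht ht.1
  rw [map_sub] at hlt
  simp only at this
  linarith

end Cones

theorem IsRoundCone.isClosedConvexCone {n : ℕ} {N : Set (Euc n)} (hN : IsRoundCone N) :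
    IsClosedConvexCone N := by
  obtain ⟨hcl, hconv, hsmul, -, hpt⟩ := hN
  refine ⟨hcl, (hpt.ge rfl).1, hsmul, fun u hu v hv => ?_⟩
  have h := hsmul 2 zero_le_two _ (hconv hu hv (by norm_num : (0 : ℝ) ≤ 1 / 2)
    (by norm_num : (0 : ℝ) ≤ 1 / 2) (by norm_num))
  simpa [smul_add, smul_smul] using h

theorem IsRoundCone.eq_zero_of_neg_mem {n : ℕ} {N : Set (Euc n)} (hN : IsRoundCone N)
    {v : Euc n} (hv : v ∈ N) (hv' : -v ∈ N) : v = 0 :=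
  hN.2.2.2.2.le ⟨hv, hv'⟩

/-- The constant family on an open set given by a round cone. -/
theorem IsRoundCone.isConeFam_prod {n : ℕ} {K : Set (Euc n)} (hK : IsRoundCone K)
    {V : Set (Euc n)} (hV : IsOpen V) : IsConeFam V (V ×ˢ K) := by
  have hfib : ∀ y ∈ V, coneFiber (V ×ˢ K) y = K := fun y hy => by
    ext v; simp [coneFiber, hy]
  refine ⟨prod_mono_right (subset_univ K), ⟨univ ×ˢ K, isClosed_univ.prod hK.1, ?_⟩,
    fun y hy => (hfib y hy).symm ▸ hK, fun y hy v hv => ⟨V, hV, hy, Subset.rfl, ?_⟩⟩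
  · rw [prod_inter_prod, univ_inter, inter_univ]
  · intro z hz
    rw [hfib y hy] at hv
    rwa [hfib z hz]

/-- Upper semicontinuity: near `x`, the fibers of a cone family lie in any conic thickening of
the fiber at `x` by a functional dominating the norm there. -/
theorem IsConeFam.eventually_infDist_lt {n : ℕ} {X : Set (Euc n)} {𝒩 : Set (Euc n × Euc n)}
    (h𝒩 : IsConeFam X 𝒩) (hX : IsOpen X) {x : Euc n} (hx : x ∈ X) {f : Euc n →L[ℝ] ℝ}
    (hf : ∀ v ∈ coneFiber 𝒩 x, ‖v‖ ≤ f v) :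
    ∀ᶠ y in 𝓝 x, ∀ τ ∈ coneFiber 𝒩 y \ {0},
      Metric.infDist τ (coneFiber 𝒩 x) < f τ := by
  obtain ⟨C, hC, hNC⟩ := h𝒩.closed
  have hN := (h𝒩.cone x hx).isClosedConvexCone
  have key : ∀ᶠ y in 𝓝 x, ∀ v ∈ Metric.sphere (0 : Euc n) 1,
      (y, v) ∈ C → Metric.infDist v (coneFiber 𝒩 x) < f v := by
    refine (isCompact_sphere (0 : Euc n) 1).eventually_forall_of_forall_eventually
      fun v hv => ?_
    by_cases hvC : (x, v) ∈ C
    · have hvN : v ∈ coneFiber 𝒩 x := by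
        change (x, v) ∈ 𝒩
        rw [hNC]
        exact ⟨hvC, hx, mem_univ v⟩
      have hlt : Metric.infDist v (coneFiber 𝒩 x) < f v := by
        rw [Metric.infDist_zero_of_mem hvN]
        have := hf v hvN
        rw [mem_sphere_zero_iff_norm.1 hv] at this
        linarith
      have ho : IsOpen {z : Euc n × Euc n | Metric.infDist z.2 (coneFiber 𝒩 x) < f z.2} :=
        isOpen_lt ((Metric.continuous_infDist_pt _).comp continuous_snd)
          (f.continuous.comp continuous_snd)
      filter_upwards [ho.mem_nhds hlt] with z hz _ using hz
    · filter_upwards [hC.isOpen_compl.mem_nhds hvC] with z hz hz' using absurd hz' hz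
  filter_upwards [key, hX.mem_nhds hx] with y hy hyX τ ⟨hτ, hτ0⟩
  have hpos : 0 < ‖τ‖ := norm_pos_iff.2 hτ0
  have hmem : ‖τ‖⁻¹ • τ ∈ coneFiber 𝒩 y :=
    (h𝒩.cone y hyX).2.2.1 _ (by positivity) τ hτ
  have hmemC : (y, ‖τ‖⁻¹ • τ) ∈ C := (hNC.le hmem).1
  have hlt := hy _ (by simp [norm_smul, hpos.ne']) hmemC
  obtain ⟨u, hu, hdist⟩ := hN.isClosed.exists_infDist_eq_dist ⟨0, hN.zero_mem⟩ (‖τ‖⁻¹ • τ)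
  have hτ_eq : τ = ‖τ‖ • ‖τ‖⁻¹ • τ := by rw [smul_smul, mul_inv_cancel₀ hpos.ne', one_smul]
  calc Metric.infDist τ (coneFiber 𝒩 x)
      ≤ dist τ (‖τ‖ • u) := Metric.infDist_le_dist_of_mem (hN.smul_mem _ hpos.le u hu)
    _ = ‖τ‖ * dist (‖τ‖⁻¹ • τ) u := by
        conv_lhs => enter [1]; rw [hτ_eq]
        rw [dist_smul₀, norm_norm]
    _ < ‖τ‖ * f (‖τ‖⁻¹ • τ) := by
        rw [← hdist]
        exact mul_lt_mul_of_pos_left hlt hpos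
    _ = f τ := by
        rw [map_smul, smul_eq_mul, mul_inv_cancel_left₀ hpos.ne']

/-- every point of `X` admits a base of neighborhoods formed by
`𝒩`-lenses. -/
theorem stmt_13 {n : ℕ} (X : Set (Euc n)) (hX : IsOpen X)
    (𝒩 : Set (Euc n × Euc n)) (h𝒩 : IsConeFam X 𝒩)
    (x : Euc n) (hx : x ∈ X) (Ω : Set (Euc n)) (hΩ : Ω ∈ nhds x) (hΩX : Ω ⊆ X) :
    ∃ Z : Set (Euc n), NLens X 𝒩 Z ∧ x ∈ interior Z ∧ Z ⊆ Ω := by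
  have hround := h𝒩.cone x hx
  have hN := hround.isClosedConvexCone
  obtain ⟨f, hf⟩ := hN.exists_norm_le fun v => hround.eq_zero_of_neg_mem
  set K := conicThickening (coneFiber 𝒩 x) f
  have hK : IsClosedConvexCone K := hN.conicThickening f
  have hNK : coneFiber 𝒩 x ⊆ K := fun v hv =>
    hN.mem_conicThickening_iff.2 ⟨v, hv, by simpa using (norm_nonneg v).trans (hf v hv)⟩
  obtain ⟨w, hw⟩ := hround.2.2.2.1
  have hwK : w ∈ interior K := interior_mono hNK hw
  have hbound : ∀ v ∈ K, ‖v‖ ≤ (‖f‖ + 2) * f v := fun v hv =>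
    hN.norm_le_of_mem_conicThickening hf hv
  have hKround : IsRoundCone K := by
    refine ⟨hK.isClosed, hK.convex, hK.smul_mem, ⟨w, hwK⟩, ?_⟩
    refine Subset.antisymm (fun v hv => ?_) ?_
    · have h₁ := nonneg_of_mem_conicThickening hv.1
      have h₂ := nonneg_of_mem_conicThickening (mem_neg.1 hv.2)
      rw [map_neg] at h₂
      have h₃ := hbound v hv.1
      rw [show f v = 0 by linarith, mul_zero] at h₃
      exact norm_le_zero_iff.1 h₃
    · rintro _ rfl
      exact ⟨hK.zero_mem, by simpa using hK.zero_mem⟩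
  obtain ⟨r, hr, hball⟩ := Metric.eventually_nhds_iff_ball.1
    ((h𝒩.eventually_infDist_lt hX hx hf).and hΩ)
  have hVΩ : Metric.ball x r ⊆ Ω := fun y hy => (hball y hy).2
  have hVX := hVΩ.trans hΩX
  have hfw : 0 ≤ f w := nonneg_of_mem_conicThickening (interior_subset hwK)
  obtain ⟨s, hs, hsmall⟩ : ∃ s : ℝ, 0 < s ∧
      (‖f‖ + 2) * (s + s * f w) + s * ‖w‖ < r := by
    set A := (‖f‖ + 2) * (1 + f w) + ‖w‖ with hA
    have hApos : 0 < A := by positivity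
    refine ⟨r / (2 * A), by positivity, ?_⟩
    calc (‖f‖ + 2) * (r / (2 * A) + r / (2 * A) * f w) + r / (2 * A) * ‖w‖
        = r / (2 * A) * A := by rw [hA]; ring
      _ = r / 2 := by field_simp
      _ < r := half_lt_self hr
  set ρ := (‖f‖ + 2) * (s + s * f w) + s * ‖w‖ with hρ
  set Z := {y | y - x + s • w ∈ interior K} ∩ {y | f (y - x) ≤ s} with hZ
  have hZρ : Z ⊆ Metric.closedBall x ρ := by
    rintro y ⟨hy₁, hy₂⟩
    have h₁ := hbound _ (interior_subset hy₁)
    have h₂ : f (y - x + s • w) ≤ s + s * f w := by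
      rw [map_add, map_smul, smul_eq_mul]
      exact add_le_add_left hy₂ _
    have h₃ : ‖y - x‖ ≤ ‖y - x + s • w‖ + ‖s • w‖ := by
      simpa using norm_sub_le (y - x + s • w) (s • w)
    rw [norm_smul, Real.norm_of_nonneg hs.le] at h₃
    rw [Metric.mem_closedBall, dist_eq_norm, hρ]
    have h₄ := mul_le_mul_of_nonneg_left h₂ (by positivity : 0 ≤ ‖f‖ + 2)
    linarith
  have hclρ : closure Z ⊆ Metric.closedBall x ρ :=
    closure_minimal hZρ Metric.isClosed_closedBall
  have hclV : closure Z ⊆ Metric.ball x r :=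
    hclρ.trans (Metric.closedBall_subset_ball hsmall)
  have hZV : Z ⊆ Metric.ball x r := subset_closure.trans hclV
  have hclX : closure Z ∩ X = closure Z := inter_eq_left.2 (hclV.trans hVX)
  have harc : ∀ γ γ' : ℝ → Euc n, IsC1ArcIn (Metric.ball x r) γ γ' →
      (∀ t ∈ Icc (0 : ℝ) 1, γ' t ∈ coneFiber (Metric.ball x r ×ˢ K) (γ t) \ {0}) →
      ∀ t ∈ Icc (0 : ℝ) 1, γ t - γ 0 ∈ K := fun γ γ' hγ hγ' t ht =>
    hK.sub_mem_of_hasDerivWithinAt hγ.deriv (fun t ht => (hγ' t ht).1.2) ht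
  refine ⟨Z, ⟨⟨hZV.trans hVX, fun z hz => ⟨Metric.ball x r, Metric.ball x r ×ˢ K,
    Metric.isOpen_ball, hclV hz.1, hVX, hKround.isConeFam_prod Metric.isOpen_ball, ?_,
    Metric.ball x r ∩ {y | y - x + s • w ∈ interior K},
    Metric.ball x r ∩ {y | s < f (y - x)}, ?_, ?_, ?_⟩⟩, ?_, ?_⟩, ?_, hZV.trans hVΩ⟩
  · rintro y hy τ ⟨hτ, hτ0⟩
    have : coneFiber (Metric.ball x r ×ˢ K) y = K := by
      ext v
      exact and_iff_right hy
    rw [this]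
    exact subset_interior_conicThickening ((hball y hy).1 τ ⟨hτ.1, hτ0⟩)
  · refine ⟨inter_subset_left, Metric.isOpen_ball.inter
      (isOpen_interior.preimage (by fun_prop)), fun γ γ' hγ h₀ hγ' t ht => ⟨hγ.maps t ht, ?_⟩⟩
    have h := hK.add_mem_interior h₀.2 (harc γ γ' hγ hγ' t ht)
    rwa [show γ 0 - x + s • w + (γ t - γ 0) = γ t - x + s • w by abel] at h
  · refine ⟨inter_subset_left, Metric.isOpen_ball.inter
      (isOpen_lt continuous_const (by fun_prop)),
      fun γ γ' hγ h₀ hγ' t ht => ⟨hγ.maps t ht, ?_⟩⟩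
    have h := nonneg_of_mem_conicThickening (harc γ γ' hγ hγ' t ht)
    have h₁ : s < f (γ 0 - x) := h₀.2
    change s < f (γ t - x)
    rw [show γ t - x = (γ 0 - x) + (γ t - γ 0) by abel, map_add]
    linarith
  · ext y
    simp only [hZ, mem_inter_iff, Set.mem_sdiff, mem_ofPred_eq, not_and, not_lt]
    tauto
  · rw [hclX]
    exact (isCompact_closedBall x ρ).of_isClosed_subset isClosed_closure hclρ
  · rw [hclX]
    refine ⟨Metric.ball x r, fun y => (-f) y, Metric.isOpen_ball, hclV, hVX, fun _ => -f,
      continuousOn_const, fun y _ => (-f).hasFDerivAt, fun y hy τ hτ => ?_⟩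
    have h := Metric.infDist_nonneg.trans_lt ((hball y hy).1 τ hτ)
    simpa using h
  · have ho : IsOpen ({y | y - x + s • w ∈ interior K} ∩ {y | f (y - x) < s}) :=
      (isOpen_interior.preimage (by fun_prop)).inter (isOpen_lt (by fun_prop) continuous_const)
    refine interior_maximal (inter_subset_inter_right _
      (ofPred_subset_ofPred.2 fun y hy => le_of_lt hy)) ho ⟨?_, ?_⟩
    · have hsK : s • w ∈ interior K := by
        have hsub : (fun v => s⁻¹ • v) ⁻¹' interior K ⊆ K := fun v hv => by
          simpa [smul_smul, hs.ne'] using hK.smul_mem s hs.le _ (interior_subset hv)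
        exact interior_maximal hsub
          (isOpen_interior.preimage (continuous_const_smul s⁻¹))
          (by simpa [smul_smul, hs.ne'] using hwK)
      simpa using hsK
    · simpa using hs
end
end

section
/- Let Z be a topological space and {Z_α}_{α∈A} a finite partition of Z. Then {Z_α} comes from a closed filtration if and only if the index set A admits a linear order such that for every α ∈ A the set (closure of Z_α in Z) ∖ Z_α is closed in Z and is contained in the union of the Z_{α′} with α′ < α. -/
open Set

noncomputable section

/-- If the blocks of a partition are the successive differences of an increasing sequence of
closed sets, their frontier parts are closed and contained in the blocks of smaller index. -/
theorem exists_order_of_comesFromClosedFiltration {Z A : Type*} [TopologicalSpace Z]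
    {P : A → Set Z} (hne : ∀ a, (P a).Nonempty)
    (hdisj : ∀ a b : A, a ≠ b → Disjoint (P a) (P b)) (hcov : ⋃ a, P a = univ)
    (h : ComesFromClosedFiltration (univ : Set Z) (range P)) :
    ∃ r : A → A → Prop, IsStrictTotalOrder A r ∧
      ∀ a : A, IsClosed (closure (P a) \ P a) ∧
        closure (P a) \ P a ⊆ ⋃ b, ⋃ (_ : r b a), P b := by
  obtain ⟨m, F, -, -, hstep, hclosed, hP⟩ := h
  have hmono : ∀ i j, i ≤ j → j ≤ m → F i ⊆ F j := by
    intro i j hij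
    induction j, hij using Nat.le_induction with
    | base => exact fun _ => Subset.rfl
    | succ j _ ih => exact fun hj => (ih (by omega)).trans (hstep j (by omega))
  have hF : ∀ i ≤ m, IsClosed (F i) := by
    intro i hi
    obtain ⟨C, hC, hFC⟩ := hclosed i hi
    rwa [hFC, inter_univ]
  have hidx : ∀ a, ∃ i, 1 ≤ i ∧ i ≤ m ∧ P a = F i \ F (i - 1) := by
    intro a
    have ha : P a ∈ range P := mem_range_self a
    rw [hP] at ha
    exact ha.2
  choose f hf1 hfm hfP using hidx
  have hinj : Function.Injective f := by
    intro a b hab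
    by_contra hne'
    have hd := hdisj a b hne'
    rw [hfP a, hab, ← hfP b] at hd
    exact (hne b).ne_empty (disjoint_self.mp hd)
  have hsub : ∀ a, closure (P a) ⊆ F (f a) := fun a =>
    closure_minimal ((hfP a).subset.trans sdiff_subset) (hF _ (hfm a))
  have heq : ∀ a, closure (P a) \ P a = closure (P a) ∩ F (f a - 1) := by
    intro a
    ext x
    constructor
    · rintro ⟨hx, hxP⟩
      rw [hfP a] at hxP
      exact ⟨hx, by_contra fun hx' => hxP ⟨hsub a hx, hx'⟩⟩
    · rintro ⟨hx, hxF⟩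
      refine ⟨hx, fun hxP => ?_⟩
      rw [hfP a] at hxP
      exact hxP.2 hxF
  let _ : LinearOrder A := LinearOrder.lift' f hinj
  refine ⟨fun a b => a < b, inferInstance, fun a => ⟨?_, ?_⟩⟩
  · rw [heq a]
    exact isClosed_closure.inter (hF _ ((Nat.sub_le _ _).trans (hfm a)))
  · rw [heq a]
    rintro x ⟨-, hx⟩
    obtain ⟨b, hb⟩ := mem_iUnion.mp (hcov.symm.subset (mem_univ x))
    refine mem_iUnion₂.mpr ⟨b, ?_, hb⟩
    change f b < f a
    by_contra! hab
    rw [hfP b] at hb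
    exact hb.2 (hmono _ _ (by omega) ((Nat.sub_le _ _).trans (hfm b)) hx)

/-- If the blocks of a finite partition are linearly ordered so that the closure of each adds only
points of smaller blocks, then the unions of initial segments form a closed filtration. -/
theorem comesFromClosedFiltration_of_linearOrder {Z A : Type*} [TopologicalSpace Z] [Finite A]
    [LinearOrder A] {P : A → Set Z} (hne : ∀ a, (P a).Nonempty)
    (hdisj : ∀ a b : A, a ≠ b → Disjoint (P a) (P b)) (hcov : ⋃ a, P a = univ)
    (h : ∀ a, closure (P a) \ P a ⊆ ⋃ b, ⋃ (_ : b < a), P b) :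
    ComesFromClosedFiltration (univ : Set Z) (range P) := by
  have := Fintype.ofFinite A
  let e : Fin (Fintype.card A) ≃o A := Fintype.orderIsoFinOfCardEq A rfl
  let F : ℕ → Set Z := fun i => ⋃ a, ⋃ (_ : (e.symm a : ℕ) < i), P a
  have hmem : ∀ {x i}, x ∈ F i ↔ ∃ a, (e.symm a : ℕ) < i ∧ x ∈ P a := by
    intro x i
    simp [F]
  have hclosed : ∀ i, IsClosed (F i) := by
    intro i
    have hF : F i = ⋃ a, ⋃ (_ : (e.symm a : ℕ) < i), closure (P a) := by
      refine (iUnion₂_mono fun a _ => subset_closure).antisymm (iUnion₂_subset fun a ha x hx => ?_)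
      by_cases hxa : x ∈ P a
      · exact hmem.mpr ⟨a, ha, hxa⟩
      · obtain ⟨b, hba, hxb⟩ := mem_iUnion₂.mp (h a ⟨hx, hxa⟩)
        have hlt : e.symm b < e.symm a := e.symm.lt_iff_lt.mpr hba
        exact hmem.mpr ⟨b, lt_trans hlt ha, hxb⟩
    rw [hF]
    exact isClosed_iUnion_of_finite fun a => isClosed_iUnion_of_finite fun _ => isClosed_closure
  have hdiff : ∀ a, P a = F ((e.symm a : ℕ) + 1) \ F (e.symm a : ℕ) := by
    intro a
    ext x
    constructor
    · refine fun hx => ⟨hmem.mpr ⟨a, Nat.lt_succ_self _, hx⟩, fun hx' => ?_⟩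
      obtain ⟨b, hb, hxb⟩ := hmem.mp hx'
      have hba : b ≠ a := by
        rintro rfl
        exact lt_irrefl _ hb
      exact disjoint_left.mp (hdisj b a hba) hxb hx
    · rintro ⟨hx, hx'⟩
      obtain ⟨b, hb, hxb⟩ := hmem.mp hx
      have hb' : ¬ (e.symm b : ℕ) < e.symm a := fun hlt => hx' (hmem.mpr ⟨b, hlt, hxb⟩)
      have hba : b = a := e.symm.injective (Fin.ext (by omega))
      exact hba ▸ hxb
  refine ⟨Fintype.card A, F, ?_, ?_, ?_, fun i _ => ⟨F i, hclosed i, (inter_univ _).symm⟩, ?_⟩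
  · simp [F]
  · simp [F, hcov]
  · intro i _ x hx
    obtain ⟨a, ha, hxa⟩ := hmem.mp hx
    exact hmem.mpr ⟨a, Nat.lt_succ_of_lt ha, hxa⟩
  · ext B
    constructor
    · rintro ⟨a, rfl⟩
      exact ⟨hne a, (e.symm a : ℕ) + 1, Nat.succ_pos _, (e.symm a).isLt, hdiff a⟩
    · rintro ⟨-, i, hi1, him, rfl⟩
      refine ⟨e ⟨i - 1, by omega⟩, ?_⟩
      rw [hdiff, e.symm_apply_apply]
      simp only [Nat.sub_add_cancel hi1]

/-- a finite partition `{Z_α}` of a topological space comes from a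
closed filtration iff the index set admits a linear (strict total) order such that
`closure(Z_α) \ Z_α` is closed and contained in `⋃_{α' < α} Z_{α'}`. -/
theorem stmt_14 {Z : Type*} [TopologicalSpace Z] {A : Type*} [Finite A]
    (P : A → Set Z) (hne : ∀ a, (P a).Nonempty)
    (hdisj : ∀ a b : A, a ≠ b → Disjoint (P a) (P b)) (hcov : ⋃ a, P a = univ) :
    ComesFromClosedFiltration (univ : Set Z) (range P) ↔
      ∃ r : A → A → Prop, IsStrictTotalOrder A r ∧
        ∀ a : A, IsClosed (closure (P a) \ P a) ∧
          closure (P a) \ P a ⊆ ⋃ b, ⋃ (_ : r b a), P b := by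
  constructor
  · exact exists_order_of_comesFromClosedFiltration hne hdisj hcov
  · rintro ⟨r, hr, h⟩
    classical
    let _ : LinearOrder A := linearOrderOfSTO r
    exact comesFromClosedFiltration_of_linearOrder hne hdisj hcov fun a => (h a).2
end
end

section
/- Let Z be a topological space, let {Z_α} be a partition of Z coming from a closed filtration, and let {Z_β} be a partition of Z refining {Z_α} such that for each α the members of {Z_β} contained in Z_α form a partition of Z_α (with the subspace topology) coming from a closed filtration of Z_α. Then {Z_β} comes from a closed filtration of Z. -/
open Set

noncomputable section

/-- Closed filtrations of a closed set `S` and of a disjoint set `A` with `S ∪ A` closed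
concatenate to a closed filtration of `S ∪ A`. -/
theorem ComesFromClosedFiltration.union {α : Type*} [TopologicalSpace α] {S A : Set α}
    {P Q : Set (Set α)} (hS : IsClosed S) (hSA : IsClosed (S ∪ A)) (hd : Disjoint S A)
    (hP : ComesFromClosedFiltration S P) (hQ : ComesFromClosedFiltration A Q) :
    ComesFromClosedFiltration (S ∪ A) (P ∪ Q) := by
  obtain ⟨m, F, hF0, hFm, hFmono, hFcl, rfl⟩ := hP
  obtain ⟨n, G, hG0, hGn, hGmono, hGcl, rfl⟩ := hQ
  let H : ℕ → Set α := fun i => if i ≤ m then F i else S ∪ G (i - m)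
  have hlow : ∀ i ≤ m, H i = F i := fun i hi => if_pos hi
  have hhigh : ∀ j, H (m + j) = S ∪ G j := by
    rintro (_ | j)
    · simp [H, hG0, hFm]
    · simp [H]
  have hGA : ∀ j ≤ n, G j ⊆ A := by
    intro j hj
    obtain ⟨C, -, hC⟩ := hGcl j hj
    exact hC ▸ inter_subset_right
  have hdiff : ∀ j < n, H (m + j + 1) \ H (m + j) = G (j + 1) \ G j := by
    intro j hj
    rw [add_assoc, hhigh, hhigh, union_sdiff_distrib, sdiff_eq_empty.2 subset_union_left,
      empty_union, ← sdiff_sdiff, (hd.symm.mono_left (hGA (j + 1) hj)).sdiff_eq_left]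
  refine ⟨m + n, H, ?_, ?_, ?_, ?_, ?_⟩
  · rw [hlow 0 m.zero_le, hF0]
  · rw [hhigh, hGn]
  · intro i hi
    rcases lt_or_ge i m with him | him
    · rw [hlow i him.le, hlow (i + 1) him]
      exact hFmono i him
    · obtain ⟨j, rfl⟩ := Nat.exists_eq_add_of_le him
      rw [add_assoc, hhigh, hhigh]
      exact union_subset_union_right S (hGmono j (by omega))
  · intro i hi
    rcases le_total i m with him | him
    · obtain ⟨C, hC, h⟩ := hFcl i him
      refine ⟨C ∩ S, hC.inter hS, ?_⟩
      rw [hlow i him, h, inter_assoc, inter_eq_left.2 subset_union_left]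
    · obtain ⟨j, rfl⟩ := Nat.exists_eq_add_of_le him
      obtain ⟨C, hC, h⟩ := hGcl j (by omega)
      refine ⟨S ∪ C ∩ (S ∪ A), hS.union (hC.inter hSA), ?_⟩
      rw [hhigh, h]
      ext x
      simp only [mem_union, mem_inter_iff]
      tauto
  · ext B
    constructor
    · rintro (⟨hB, i, hi, him, rfl⟩ | ⟨hB, i, hi, hin, rfl⟩)
      · exact ⟨hB, i, hi, by omega, by rw [hlow i him, hlow (i - 1) (by omega)]⟩
      · obtain ⟨j, rfl⟩ := Nat.exists_eq_add_of_le' hi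
        exact ⟨hB, m + j + 1, by omega, by omega, (hdiff j hin).symm⟩
    · rintro ⟨hB, i, hi, him, rfl⟩
      rcases le_or_gt i m with h | h
      · rw [hlow i h, hlow (i - 1) (by omega)] at hB ⊢
        exact Or.inl ⟨hB, i, hi, h, rfl⟩
      · obtain ⟨j, rfl⟩ := Nat.exists_eq_add_of_lt h
        rw [Nat.add_sub_cancel, hdiff j (by omega)] at hB ⊢
        exact Or.inr ⟨hB, j + 1, by omega, by omega, rfl⟩

/-- transitivity of coming from a closed filtration. -/
theorem stmt_15 {α : Type*} [TopologicalSpace α] (Ps Qs : Set (Set α))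
    (hPs : IsPartitionOf (univ : Set α) Ps) (hQs : IsPartitionOf (univ : Set α) Qs)
    (hrefine : ∀ B ∈ Qs, ∃ A ∈ Ps, B ⊆ A)
    (h1 : ComesFromClosedFiltration (univ : Set α) Ps)
    (h2 : ∀ A ∈ Ps, ComesFromClosedFiltration A {B | B ∈ Qs ∧ B ⊆ A}) :
    ComesFromClosedFiltration (univ : Set α) Qs := by
  obtain ⟨m, F, hF0, hFm, hFmono, hFcl, hF⟩ := h1
  have hclosed : ∀ i ≤ m, IsClosed (F i) := by
    intro i hi
    obtain ⟨C, hC, h⟩ := hFcl i hi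
    rwa [h, inter_univ]
  have key : ∀ k ≤ m, ComesFromClosedFiltration (F k) {B | B ∈ Qs ∧ B ⊆ F k} := by
    intro k
    induction k with
    | zero =>
      intro _
      refine ⟨0, fun _ => ∅, rfl, hF0.symm, by simp, fun _ _ => ⟨∅, isClosed_empty, by simp⟩, ?_⟩
      ext B
      simp only [hF0, subset_empty_iff, mem_ofPred_eq]
      constructor
      · rintro ⟨hB, rfl⟩
        exact absurd (hQs.2.1 ∅ hB) not_nonempty_empty
      · rintro ⟨-, i, hi, hi0, -⟩
        omega
    | succ k ih =>
      intro hk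
      have ih := ih (by omega)
      have hsub : F k ⊆ F (k + 1) := hFmono k hk
      rcases (F (k + 1) \ F k).eq_empty_or_nonempty with he | hne
      · rwa [(sdiff_eq_empty.1 he).antisymm hsub]
      · have hA : F (k + 1) \ F k ∈ Ps := hF ▸ ⟨hne, k + 1, by omega, hk, rfl⟩
        have hun : F k ∪ F (k + 1) \ F k = F (k + 1) := union_sdiff_cancel hsub
        have h := ih.union (hclosed k (by omega)) (hun.symm ▸ hclosed (k + 1) hk)
          disjoint_sdiff_right (h2 _ hA)
        rw [hun] at h
        convert h using 1
        ext B
        constructor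
        · rintro ⟨hB, hBF⟩
          obtain ⟨A', hA', hBA'⟩ := hrefine B hB
          by_cases hAA : A' = F (k + 1) \ F k
          · exact Or.inr ⟨hB, hAA ▸ hBA'⟩
          · have hdisj := (hPs.2.2.1 A' hA' _ hA hAA).mono_left hBA'
            refine Or.inl ⟨hB, fun x hx => ?_⟩
            by_contra hxF
            exact disjoint_left.1 hdisj hx ⟨hBF hx, hxF⟩
        · rintro (⟨hB, hBF⟩ | ⟨hB, hBF⟩)
          · exact ⟨hB, hBF.trans hsub⟩
          · exact ⟨hB, hBF.trans sdiff_subset⟩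
  simpa [hFm] using key m le_rfl
end
end

section
/- Let Z be a topological space and let {Z_α} and {Z′_β} be two partitions of Z, each coming from a closed filtration. Then their common refinement, the partition consisting of the nonempty sets Z_α ∩ Z′_β, also comes from a closed filtration; in particular, the set of partitions of Z coming from closed filtrations is directed under refinement. -/
open Set

noncomputable section

/-- A partition of the whole space comes from a closed filtration iff it consists of the nonempty
successive differences of an infinite monotone sequence of closed sets that starts at `∅` and
reaches the whole space. -/
lemma comesFromClosedFiltration_univ_iff {α : Type*} [TopologicalSpace α] {Ps : Set (Set α)} :
    ComesFromClosedFiltration univ Ps ↔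
      ∃ (m : ℕ) (F : ℕ → Set α), F 0 = ∅ ∧ F m = univ ∧ Monotone F ∧ (∀ i, IsClosed (F i)) ∧
        Ps = {A | A.Nonempty ∧ ∃ i, A = F (i + 1) \ F i} := by
  constructor
  · rintro ⟨m, F, h0, hm, hmono, hclosed, rfl⟩
    refine ⟨m, fun i => F (min i m), by simpa using h0, by simpa using hm, ?_, fun i => ?_, ?_⟩
    · refine monotone_nat_of_le_succ fun i => ?_
      rcases lt_or_ge i m with h | h
      · simpa [h.le, Nat.succ_le_of_lt h] using hmono i h
      · simp [h, h.trans (Nat.le_succ i)]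
    · obtain ⟨C, hC, hF⟩ := hclosed (min i m) (min_le_right i m)
      simpa [hF] using hC
    · ext A
      refine and_congr_right fun hA => ⟨?_, ?_⟩
      · rintro ⟨i, hi, him, rfl⟩
        refine ⟨i - 1, ?_⟩
        simp [Nat.sub_add_cancel hi, him, (Nat.sub_le i 1).trans him]
      · rintro ⟨i, rfl⟩
        rcases lt_or_ge i m with h | h
        · exact ⟨i + 1, by omega, h, by simp [h.le, Nat.succ_le_of_lt h]⟩
        · simp [h, h.trans (Nat.le_succ i)] at hA
  · rintro ⟨m, F, h0, hm, hmono, hclosed, rfl⟩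
    refine ⟨m, F, h0, hm, fun i _ => hmono i.le_succ, fun i _ => ⟨F i, hclosed i, by simp⟩, ?_⟩
    ext A
    refine and_congr_right fun hA => ⟨?_, ?_⟩
    · rintro ⟨i, rfl⟩
      refine ⟨i + 1, by omega, ?_, rfl⟩
      by_contra h
      have hi : F i = univ := univ_subset_iff.1 (hm ▸ hmono (by omega))
      simp [hi] at hA
    · rintro ⟨i, hi, -, rfl⟩
      exact ⟨i - 1, by rw [Nat.sub_add_cancel hi]⟩

/-- The filtration `F` refined by the filtration `G`, in lexicographic order: `N` steps of `G`
between any two successive terms of `F`. -/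
def lexFiltration {α : Type*} (F G : ℕ → Set α) (N k : ℕ) : Set α :=
  F (k / N) ∪ (F (k / N + 1) ∩ G (k % N))

section lexFiltration

variable {α : Type*} {F G : ℕ → Set α} {N : ℕ}

lemma lexFiltration_mul_add {i j : ℕ} (hj : j < N) :
    lexFiltration F G N (N * i + j) = F i ∪ (F (i + 1) ∩ G j) := by
  have hN : 0 < N := by omega
  simp [lexFiltration, Nat.mul_add_div hN, Nat.div_eq_of_lt hj,
    Nat.mod_eq_of_lt hj]

lemma lexFiltration_mul_add_succ (hF : Monotone F) (h0 : G 0 = ∅) (hN : G N = univ) {i j : ℕ}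
    (hj : j < N) :
    lexFiltration F G N (N * i + j + 1) = F i ∪ (F (i + 1) ∩ G (j + 1)) := by
  rcases Nat.lt_or_ge (j + 1) N with h | h
  · exact lexFiltration_mul_add h
  · obtain rfl : N = j + 1 := by omega
    have := lexFiltration_mul_add (F := F) (G := G) (i := i + 1) (Nat.succ_pos j)
    rw [show (j + 1) * i + j + 1 = (j + 1) * (i + 1) + 0 by ring, this, h0, hN]
    simpa using (union_eq_right.2 (hF i.le_succ)).symm

lemma lexFiltration_diff (hF : Monotone F) (h0 : G 0 = ∅) (hN : G N = univ) {i j : ℕ}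
    (hj : j < N) :
    lexFiltration F G N (N * i + j + 1) \ lexFiltration F G N (N * i + j) =
      (F (i + 1) \ F i) ∩ (G (j + 1) \ G j) := by
  rw [lexFiltration_mul_add_succ hF h0 hN hj, lexFiltration_mul_add hj]
  ext x
  simp only [mem_sdiff, mem_union, mem_inter_iff]
  tauto

lemma monotone_lexFiltration (hF : Monotone F) (hG : Monotone G) (h0 : G 0 = ∅) (hN : G N = univ)
    (hpos : 0 < N) : Monotone (lexFiltration F G N) := by
  refine monotone_nat_of_le_succ fun k => ?_
  have hk := Nat.mod_lt k hpos
  rw [← Nat.div_add_mod k N, lexFiltration_mul_add_succ hF h0 hN hk, lexFiltration_mul_add hk]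
  exact union_subset_union_right _ (inter_subset_inter_right _ (hG (Nat.le_succ _)))

end lexFiltration

/-- The common refinement of two partitions coming from closed filtrations comes from a closed
filtration. -/
lemma ComesFromClosedFiltration.inter {α : Type*} [TopologicalSpace α] {Ps Qs : Set (Set α)}
    (h1 : ComesFromClosedFiltration univ Ps) (h2 : ComesFromClosedFiltration univ Qs) :
    ComesFromClosedFiltration univ {C | C.Nonempty ∧ ∃ A ∈ Ps, ∃ B ∈ Qs, C = A ∩ B} := by
  rw [comesFromClosedFiltration_univ_iff] at h1 h2 ⊢
  obtain ⟨m, F, hF0, hFm, hF, hFc, rfl⟩ := h1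
  obtain ⟨n, G, hG0, hGn, hG, hGc, rfl⟩ := h2
  have hpos : 0 < n + 1 := n.succ_pos
  have hN : G (n + 1) = univ := univ_subset_iff.1 (hGn ▸ hG n.le_succ)
  refine ⟨(n + 1) * m, lexFiltration F G (n + 1), by simp [lexFiltration, hF0, hG0],
    by simp [lexFiltration, hFm], monotone_lexFiltration hF hG hG0 hN hpos,
    fun k => (hFc _).union ((hFc _).inter (hGc _)), ?_⟩
  ext C
  refine and_congr_right fun hC => ⟨?_, ?_⟩
  · rintro ⟨_, ⟨-, i, rfl⟩, _, ⟨hB, j, rfl⟩, rfl⟩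
    have hj : j < n + 1 := by
      by_contra h
      have hj : G j = univ := univ_subset_iff.1 (hN ▸ hG (by omega))
      simp [hj] at hB
    exact ⟨(n + 1) * i + j, (lexFiltration_diff hF hG0 hN hj).symm⟩
  · rintro ⟨k, rfl⟩
    have h := lexFiltration_diff (i := k / (n + 1)) hF hG0 hN (Nat.mod_lt k hpos)
    rw [Nat.div_add_mod] at h
    rw [h] at hC ⊢
    exact ⟨_, ⟨hC.mono inter_subset_left, _, rfl⟩, _, ⟨hC.mono inter_subset_right, _, rfl⟩, rfl⟩

/-- The nonempty intersections of members of two partitions form a partition. -/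
lemma IsPartitionOf.inter {α : Type*} {S T : Set α} {Ps Qs : Set (Set α)}
    (hPs : IsPartitionOf S Ps) (hQs : IsPartitionOf T Qs) :
    IsPartitionOf (S ∩ T) {C | C.Nonempty ∧ ∃ A ∈ Ps, ∃ B ∈ Qs, C = A ∩ B} := by
  obtain ⟨hPfin, -, hPdisj, rfl⟩ := hPs
  obtain ⟨hQfin, -, hQdisj, rfl⟩ := hQs
  refine ⟨(hPfin.image2 (· ∩ ·) hQfin).subset ?_, fun C hC => hC.1, ?_, ?_⟩
  · rintro _ ⟨-, A, hA, B, hB, rfl⟩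
    exact ⟨A, hA, B, hB, rfl⟩
  · rintro _ ⟨-, A, hA, B, hB, rfl⟩ _ ⟨-, A', hA', B', hB', rfl⟩ hne
    by_cases h : A = A'
    · subst h
      have hBne : B ≠ B' := fun h => hne (h ▸ rfl)
      exact (hQdisj B hB B' hB' hBne).mono inter_subset_right inter_subset_right
    · exact (hPdisj A hA A' hA' h).mono inter_subset_left inter_subset_left
  · ext x
    constructor
    · rintro ⟨_, ⟨-, A, hA, B, hB, rfl⟩, hxA, hxB⟩
      exact ⟨⟨A, hA, hxA⟩, ⟨B, hB, hxB⟩⟩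
    · rintro ⟨⟨A, hA, hxA⟩, ⟨B, hB, hxB⟩⟩
      exact ⟨A ∩ B, ⟨⟨x, hxA, hxB⟩, A, hA, B, hB, rfl⟩, hxA, hxB⟩

/-- the common refinement of two partitions coming from closed
filtrations also comes from a closed filtration; hence such partitions are directed
under refinement. -/
theorem stmt_16 {α : Type*} [TopologicalSpace α] (Ps Qs : Set (Set α))
    (hPs : IsPartitionOf (univ : Set α) Ps) (hQs : IsPartitionOf (univ : Set α) Qs)
    (h1 : ComesFromClosedFiltration (univ : Set α) Ps)
    (h2 : ComesFromClosedFiltration (univ : Set α) Qs) :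
    IsPartitionOf (univ : Set α) {C | C.Nonempty ∧ ∃ A ∈ Ps, ∃ B ∈ Qs, C = A ∩ B} ∧
    ComesFromClosedFiltration (univ : Set α)
      {C | C.Nonempty ∧ ∃ A ∈ Ps, ∃ B ∈ Qs, C = A ∩ B} ∧
    (∀ C ∈ {C : Set α | C.Nonempty ∧ ∃ A ∈ Ps, ∃ B ∈ Qs, C = A ∩ B}, ∃ A ∈ Ps, C ⊆ A) ∧
    (∀ C ∈ {C : Set α | C.Nonempty ∧ ∃ A ∈ Ps, ∃ B ∈ Qs, C = A ∩ B}, ∃ B ∈ Qs, C ⊆ B) := by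
  refine ⟨by simpa using hPs.inter hQs, h1.inter h2, ?_, ?_⟩
  · rintro _ ⟨-, A, hA, B, -, rfl⟩
    exact ⟨A, hA, inter_subset_left⟩
  · rintro _ ⟨-, A, -, B, hB, rfl⟩
    exact ⟨B, hB, inter_subset_right⟩
end
end

section
/- Let X ⊆ ℝⁿ be an open set, let 𝒩 be a continuous round cone family on X, let Z ⊆ X be an 𝒩-lens, and let 𝒰 be a family of open subsets of X covering the closure of Z in X. Then there exists an 𝒩-special partition {Z_α} of Z such that each Z_α is contained in some member of 𝒰. -/
open Set

noncomputable section

lemma isPartitionOf_of_filtration {α : Type*} {S : Set α} {m : ℕ} {F : ℕ → Set α}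
    (h0 : F 0 = ∅) (hm : F m = S) (hF : ∀ i < m, F i ⊆ F (i + 1)) :
    IsPartitionOf S {A | A.Nonempty ∧ ∃ i, 1 ≤ i ∧ i ≤ m ∧ A = F i \ F (i - 1)} := by
  have mono : ∀ i j, i ≤ j → j ≤ m → F i ⊆ F j := by
    intro i j hij
    induction j, hij using Nat.le_induction with
    | base => exact fun _ => subset_rfl
    | succ j _ ih => exact fun hj => (ih (by omega)).trans (hF j (by omega))
  have disj : ∀ i j, i < j → j ≤ m → Disjoint (F i \ F (i - 1)) (F j \ F (j - 1)) := by
    intro i j hij hj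
    rw [Set.disjoint_left]
    exact fun x hx hx' => hx'.2 (mono i (j - 1) (by omega) (by omega) hx.1)
  refine ⟨?_, fun A hA => hA.1, ?_, ?_⟩
  · refine ((Set.finite_Iic m).image fun i => F i \ F (i - 1)).subset ?_
    rintro A ⟨-, i, -, hi, rfl⟩
    exact ⟨i, hi, rfl⟩
  · rintro A ⟨-, i, -, hi, rfl⟩ B ⟨-, j, -, hj, rfl⟩ hne
    rcases lt_trichotomy i j with h | rfl | h
    · exact disj i j h hj
    · exact absurd rfl hne
    · exact (disj j i h hi).symm
  · ext x
    constructor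
    · rintro ⟨A, ⟨-, i, -, hi, rfl⟩, hx⟩
      exact hm ▸ mono i m hi le_rfl hx.1
    · intro hx
      classical
      have hex : ∃ i, x ∈ F i := ⟨m, hm ▸ hx⟩
      have hpos : 1 ≤ Nat.find hex := by
        rw [Nat.one_le_iff_ne_zero]
        intro h
        have := Nat.find_spec hex
        rw [h, h0] at this
        exact this
      have hmem : x ∈ F (Nat.find hex) \ F (Nat.find hex - 1) :=
        ⟨Nat.find_spec hex, Nat.find_min hex (by omega)⟩
      exact ⟨_, ⟨⟨x, hmem⟩, _, hpos, Nat.find_min' hex (hm ▸ hx), rfl⟩, hmem⟩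

/-- An increasing sequence of open sets exhausting `S` induces a partition of `S` coming from
a closed filtration. -/
lemma exists_partition_of_open_filtration {α : Type*} [TopologicalSpace α] {S : Set α} {M : ℕ}
    {O : ℕ → Set α} (h0 : O 0 = ∅) (hM : S ⊆ O M) (hmono : Monotone O)
    (hopen : ∀ i, IsOpen (O i)) :
    ∃ Ps : Set (Set α), IsPartitionOf S Ps ∧ ComesFromClosedFiltration S Ps ∧
      ∀ A ∈ Ps, A.Nonempty ∧ ∃ i < M, A = S ∩ (O (i + 1) \ O i) := by
  have hF0 : S \ O (M - 0) = ∅ := by simpa [Set.sdiff_eq_empty] using hM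
  have hFM : S \ O (M - M) = S := by simp [h0]
  have hF : ∀ i < M, S \ O (M - i) ⊆ S \ O (M - (i + 1)) := fun i _ =>
    Set.sdiff_subset_sdiff_right (hmono (by omega))
  refine ⟨_, isPartitionOf_of_filtration (F := fun l => S \ O (M - l)) hF0 hFM hF,
    ⟨M, _, hF0, hFM, hF, fun i _ => ⟨(O (M - i))ᶜ, (hopen _).isClosed_compl, ?_⟩, rfl⟩, ?_⟩
  · rw [Set.inter_comm]
    rfl
  · rintro A ⟨hA, i, hi1, hi, rfl⟩
    refine ⟨hA, M - i, by omega, ?_⟩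
    have h : M - (i - 1) = M - i + 1 := by omega
    ext x
    simp only [h, Set.mem_sdiff, Set.mem_inter_iff]
    tauto

section NOpen

variable {n : ℕ} {V V' U U' : Set (Euc n)} {𝒩 𝒩' : Set (Euc n × Euc n)}

lemma IsC1ArcIn.mono {γ γ' : ℝ → Euc n} (h : IsC1ArcIn V γ γ') (hV : V ⊆ V') :
    IsC1ArcIn V' γ γ' :=
  ⟨fun t ht => hV (h.maps t ht), h.deriv, h.cont⟩

lemma NOpen.restrict (h : NOpen V 𝒩 U) (hV : V' ⊆ V) (hV' : IsOpen V') (hN : 𝒩' ⊆ 𝒩) :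
    NOpen V' 𝒩' (U ∩ V') :=
  ⟨inter_subset_right, h.2.1.inter hV', fun γ γ' harc h0 hγ t ht =>
    ⟨h.2.2 γ γ' (harc.mono hV) h0.1 (fun s hs => ⟨hN (hγ s hs).1, (hγ s hs).2⟩) t ht,
      harc.maps t ht⟩⟩

lemma NOpen.inter (h : NOpen V 𝒩 U) (h' : NOpen V 𝒩 U') : NOpen V 𝒩 (U ∩ U') :=
  ⟨inter_subset_left.trans h.1, h.2.1.inter h'.2.1, fun γ γ' harc h0 hγ t ht =>
    ⟨h.2.2 γ γ' harc h0.1 hγ t ht, h'.2.2 γ γ' harc h0.2 hγ t ht⟩⟩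

lemma NOpen.union (h : NOpen V 𝒩 U) (h' : NOpen V 𝒩 U') : NOpen V 𝒩 (U ∪ U') :=
  ⟨union_subset h.1 h'.1, h.2.1.union h'.2.1, fun γ γ' harc h0 hγ t ht =>
    h0.imp (fun h0 => h.2.2 γ γ' harc h0 hγ t ht) (fun h0 => h'.2.2 γ γ' harc h0 hγ t ht)⟩

lemma NOpen.iUnion {ι : Sort*} {U : ι → Set (Euc n)} (h : ∀ i, NOpen V 𝒩 (U i)) :
    NOpen V 𝒩 (⋃ i, U i) := by
  refine ⟨iUnion_subset fun i => (h i).1, isOpen_iUnion fun i => (h i).2.1,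
    fun γ γ' harc h0 hγ t ht => ?_⟩
  obtain ⟨i, hi⟩ := mem_iUnion.1 h0
  exact mem_iUnion.2 ⟨i, (h i).2.2 γ γ' harc hi hγ t ht⟩

/-- Strict sublevel sets of a function decreasing along `𝒩` are `𝒩`-open. -/
lemma nOpen_sublevel (hV : IsOpen V) {f : Euc n → ℝ} {df : Euc n → Euc n →L[ℝ] ℝ}
    (hf : ∀ x ∈ V, HasFDerivAt f (df x) x)
    (hneg : ∀ x ∈ V, ∀ τ ∈ coneFiber 𝒩 x, df x τ ≤ 0) (b : ℝ) :
    NOpen V 𝒩 (V ∩ {x | f x < b}) := by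
  refine ⟨inter_subset_left, ?_, fun γ γ' harc h0 hγ t ht => ⟨harc.maps t ht, ?_⟩⟩
  · have hc : ContinuousOn f V := fun x hx => (hf x hx).continuousAt.continuousWithinAt
    exact hc.isOpen_inter_preimage hV isOpen_Iio
  · have hd : ∀ s ∈ Icc (0 : ℝ) 1,
        HasDerivWithinAt (f ∘ γ) (df (γ s) (γ' s)) (Icc (0 : ℝ) 1) s := fun s hs =>
      (hf _ (harc.maps s hs)).comp_hasDerivWithinAt s (harc.deriv s hs)
    have hanti : AntitoneOn (f ∘ γ) (Icc (0 : ℝ) 1) := by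
      refine antitoneOn_of_hasDerivWithinAt_nonpos (convex_Icc 0 1)
        (fun s hs => (hd s hs).continuousWithinAt)
        (fun s hs => (hd s (interior_subset hs)).mono interior_subset) (fun s hs => ?_)
      have hs := interior_subset hs
      exact hneg _ (harc.maps s hs) _ (hγ s hs).1
    exact (hanti (left_mem_Icc.2 zero_le_one) ht ht.1).trans_lt h0.2

end NOpen

/-- The cone family over `V` of vectors on which `df` decreases with slope at least `a`. -/
def slopeCone {n : ℕ} (V : Set (Euc n)) (df : Euc n → Euc n →L[ℝ] ℝ) (a : ℝ) :
    Set (Euc n × Euc n) :=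
  {q | q.1 ∈ V ∧ df q.1 q.2 + a * ‖q.2‖ ≤ 0}

section SlopeCone

variable {n : ℕ} {V V₀ : Set (Euc n)} {df : Euc n → Euc n →L[ℝ] ℝ} {a : ℝ}
  {𝒩 : Set (Euc n × Euc n)}

lemma slope_lt_of_mem_interior {x v w : Euc n} (ha : 0 ≤ a)
    (hv : v ∈ interior (coneFiber (slopeCone V df a) x)) (hw : df x w + a * ‖w‖ < 0) :
    df x v + a * ‖v‖ < 0 := by
  have hlim : Filter.Tendsto (fun t : ℝ => v + t • (v - w)) (nhds 0) (nhds v) := by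
    have : Continuous fun t : ℝ => v + t • (v - w) := by fun_prop
    simpa using this.tendsto 0
  have hev := hlim.eventually (mem_interior_iff_mem_nhds.1 hv)
  obtain ⟨t, ht, ht0⟩ : ∃ t : ℝ, v + t • (v - w) ∈ coneFiber (slopeCone V df a) x ∧ 0 < t :=
    ((hev.filter_mono (nhdsWithin_le_nhds (s := Ioi 0))).and self_mem_nhdsWithin).exists
  have h1 : df x (v + t • (v - w)) + a * ‖v + t • (v - w)‖ ≤ 0 := ht.2
  have h2 : (1 + t) * ‖v‖ ≤ ‖v + t • (v - w)‖ + t * ‖w‖ := by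
    have h := norm_add_le (v + t • (v - w)) (t • w)
    rw [show v + t • (v - w) + t • w = (1 + t) • v by module, norm_smul, norm_smul,
      Real.norm_of_nonneg ht0.le, Real.norm_of_nonneg (by linarith)] at h
    exact h
  simp only [map_add, map_smul, map_sub, smul_eq_mul] at h1
  have h3 := mul_le_mul_of_nonneg_left h2 ha
  have h4 := mul_neg_of_pos_of_neg ht0 hw
  by_contra hcon
  nlinarith

lemma mem_interior_slopeCone {x v : Euc n} (hx : x ∈ V) (hv : df x v + a * ‖v‖ < 0) :
    v ∈ interior (coneFiber (slopeCone V df a) x) := by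
  have hc : Continuous fun v => df x v + a * ‖v‖ := by fun_prop
  have hsub : {u | df x u + a * ‖u‖ < 0} ⊆ coneFiber (slopeCone V df a) x := fun u hu =>
    ⟨hx, le_of_lt hu⟩
  exact interior_maximal hsub (isOpen_Iio.preimage hc) hv

lemma isConeFam_inter_slopeCone (hV : IsOpen V) (hV₀ : IsOpen V₀) (ha : 0 ≤ a)
    (hdf : ContinuousOn df V₀) (h𝒩 : IsConeFam V 𝒩)
    (hint : ∀ x ∈ V ∩ V₀, ∃ w ∈ interior (coneFiber 𝒩 x), df x w + a * ‖w‖ < 0) :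
    IsConeFam (V ∩ V₀) (𝒩 ∩ slopeCone V₀ df a) := by
  have hfib : ∀ x, coneFiber (𝒩 ∩ slopeCone V₀ df a) x
      = coneFiber 𝒩 x ∩ coneFiber (slopeCone V₀ df a) x := fun _ => rfl
  refine ⟨fun q hq => ⟨⟨(h𝒩.subset hq.1).1, hq.2.1⟩, trivial⟩, ?_, fun x hx => ?_,
    fun x hx v hv => ?_⟩
  · obtain ⟨C, hC, hCe⟩ := h𝒩.closed
    have hc : ContinuousOn (fun q : Euc n × Euc n => df q.1 q.2 + a * ‖q.2‖)
        (V₀ ×ˢ (univ : Set (Euc n))) := by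
      refine ContinuousOn.add ?_ (by fun_prop)
      exact (hdf.comp continuousOn_fst fun q hq => hq.1).clm_apply continuousOn_snd
    obtain ⟨C', hC', hCe'⟩ := continuousOn_iff_isClosed.1 hc (Iic 0) isClosed_Iic
    refine ⟨C ∩ C', hC.inter hC', ?_⟩
    ext q
    have h1 : q ∈ 𝒩 ↔ q ∈ C ∧ q.1 ∈ V := by rw [hCe]; simp
    have h2 := Set.ext_iff.1 hCe' q
    simp only [mem_inter_iff, mem_preimage, mem_Iic, mem_prod, mem_univ, and_true] at h2 ⊢
    simp only [slopeCone, mem_ofPred_eq]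
    tauto
  · obtain ⟨h1, h2, h3, -, h5⟩ := h𝒩.cone x hx.1
    have h0 : (0 : Euc n) ∈ coneFiber 𝒩 x := by
      have : (0 : Euc n) ∈ coneFiber 𝒩 x ∩ -coneFiber 𝒩 x := by rw [h5]; rfl
      exact this.1
    have h0' : (0 : Euc n) ∈ coneFiber (slopeCone V₀ df a) x := ⟨hx.2, by simp⟩
    obtain ⟨w, hw, hw'⟩ := hint x hx
    rw [hfib]
    refine ⟨h1.inter ?_, h2.inter ?_, fun c hc v hv => ⟨h3 c hc v hv.1, hx.2, ?_⟩, ?_, ?_⟩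
    · have hc : Continuous fun v => df x v + a * ‖v‖ := by fun_prop
      have : coneFiber (slopeCone V₀ df a) x = {v | df x v + a * ‖v‖ ≤ 0} := by
        ext v
        exact ⟨fun h => h.2, fun h => ⟨hx.2, h⟩⟩
      rw [this]
      exact isClosed_le hc continuous_const
    · rintro u ⟨-, hu⟩ v ⟨-, hv⟩ s t hs ht -
      refine ⟨hx.2, ?_⟩
      have hn := norm_add_le (s • u) (t • v)
      rw [norm_smul, norm_smul, Real.norm_of_nonneg hs, Real.norm_of_nonneg ht] at hn
      simp only [map_add, map_smul, smul_eq_mul] at hu hv ⊢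
      nlinarith [mul_le_mul_of_nonneg_left hn ha, mul_nonneg hs (neg_nonneg.2 hu),
        mul_nonneg ht (neg_nonneg.2 hv)]
    · have hv2 : df x v + a * ‖v‖ ≤ 0 := hv.2.2
      simp only [map_smul, smul_eq_mul, norm_smul, Real.norm_of_nonneg hc]
      nlinarith [mul_nonneg hc (neg_nonneg.2 hv2)]
    · refine ⟨w, ?_⟩
      rw [interior_inter]
      exact ⟨hw, mem_interior_slopeCone hx.2 hw'⟩
    · refine Subset.antisymm (fun v hv => ?_) ?_
      · rw [← h5]
        exact ⟨hv.1.1, hv.2.1⟩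
      · rintro v rfl
        exact ⟨⟨h0, h0'⟩, by simpa using ⟨h0, h0'⟩⟩
  · rw [hfib, interior_inter] at hv
    obtain ⟨V₁, hV₁, hx₁, -, hv₁⟩ := h𝒩.lsc x hx.1 v hv.1
    obtain ⟨w, -, hw⟩ := hint x hx
    have hlt := slope_lt_of_mem_interior ha hv.2 hw
    have hc : ContinuousOn (fun y => df y v + a * ‖v‖) V₀ :=
      (hdf.clm_apply continuousOn_const).add continuousOn_const
    have hO : IsOpen (V₀ ∩ {y | df y v + a * ‖v‖ < 0}) :=
      hc.isOpen_inter_preimage hV₀ isOpen_Iio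
    refine ⟨V ∩ V₁ ∩ (V₀ ∩ {y | df y v + a * ‖v‖ < 0}), (hV.inter hV₁).inter hO,
      ⟨⟨hx.1, hx₁⟩, hx.2, hlt⟩, fun y hy => ⟨hy.1.1, hy.2.1⟩, fun y hy => ?_⟩
    rw [hfib, interior_inter]
    exact ⟨hv₁ y hy.1.2, mem_interior_slopeCone hy.2.1 hy.2.2⟩

end SlopeCone

lemma IsRoundCone.exists_ne_zero {n : ℕ} [Nontrivial (Euc n)] {N : Set (Euc n)}
    (h : IsRoundCone N) : ∃ w ∈ interior N, w ≠ 0 := by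
  by_contra! hcon
  have hsub : interior N ⊆ interior {0} := interior_maximal hcon isOpen_interior
  rw [interior_singleton] at hsub
  obtain ⟨w, hw⟩ := h.2.2.2.1
  exact hsub hw

/-- On a compact set, an `𝒩`-smooth function decreases along `𝒩` with a uniform slope. -/
lemma exists_uniform_slope {n : ℕ} {X W K : Set (Euc n)} {𝒩 : Set (Euc n × Euc n)}
    (h𝒩 : IsConeFam X 𝒩) (hWX : W ⊆ X) (hK : IsCompact K) (hKW : K ⊆ W)
    {df : Euc n → Euc n →L[ℝ] ℝ} (hdf : ContinuousOn df W)
    (hneg : ∀ x ∈ W, ∀ τ ∈ coneFiber 𝒩 x \ {0}, df x τ < 0) :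
    ∃ a > 0, ∀ x ∈ K, ∀ τ ∈ coneFiber 𝒩 x \ {0}, df x τ + a * ‖τ‖ < 0 := by
  obtain ⟨C, hC, hCe⟩ := h𝒩.closed
  have hcomp : IsCompact ((K ×ˢ Metric.sphere (0 : Euc n) 1) ∩ C) :=
    (hK.prod (isCompact_sphere 0 1)).inter_right hC
  have hc : ContinuousOn (fun q : Euc n × Euc n => df q.1 q.2)
      ((K ×ˢ Metric.sphere (0 : Euc n) 1) ∩ C) :=
    (hdf.comp continuousOn_fst fun q hq => hKW hq.1.1).clm_apply continuousOn_snd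
  have hunit : ∃ a > 0, ∀ q ∈ (K ×ˢ Metric.sphere (0 : Euc n) 1) ∩ C, df q.1 q.2 + a < 0 := by
    rcases ((K ×ˢ Metric.sphere (0 : Euc n) 1) ∩ C).eq_empty_or_nonempty with he | hne
    · exact ⟨1, one_pos, fun q hq => absurd hq (by simp [he])⟩
    · obtain ⟨q, hq, hmax⟩ := hcomp.exists_isMaxOn hne hc
      have hq0 : df q.1 q.2 < 0 := by
        refine hneg _ (hKW hq.1.1) _ ⟨?_, ?_⟩
        · change (q.1, q.2) ∈ 𝒩
          rw [hCe]
          exact ⟨hq.2, hWX (hKW hq.1.1), trivial⟩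
        · exact ne_zero_of_mem_unit_sphere ⟨q.2, hq.1.2⟩
      refine ⟨-df q.1 q.2 / 2, by linarith, fun r hr => ?_⟩
      have : df r.1 r.2 ≤ df q.1 q.2 := hmax hr
      linarith
  obtain ⟨a, ha, hunit⟩ := hunit
  refine ⟨a, ha, fun x hx τ hτ => ?_⟩
  have hτ0 : 0 < ‖τ‖ := norm_pos_iff.2 hτ.2
  have hmem : (x, ‖τ‖⁻¹ • τ) ∈ 𝒩 :=
    (h𝒩.cone x (hWX (hKW hx))).2.2.1 _ (inv_nonneg.2 hτ0.le) τ hτ.1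
  have h := hunit (x, ‖τ‖⁻¹ • τ) ⟨⟨hx, ?_⟩, ?_⟩
  · simp only [map_smul, smul_eq_mul] at h
    have h' := mul_neg_of_pos_of_neg hτ0 h
    rw [mul_add, mul_inv_cancel_left₀ hτ0.ne'] at h'
    linarith
  · simp [norm_smul, hτ0.ne']
  · rw [hCe] at hmem
    exact hmem.1

/-- A lens cut by sets that are open for the topology of a slope cone remains a lens. -/
lemma NLens.inter_diff {n : ℕ} [Nontrivial (Euc n)] {X V₀ Z O O' : Set (Euc n)}
    {𝒩 : Set (Euc n × Euc n)} (h𝒩 : IsConeFam X 𝒩) (hZ : NLens X 𝒩 Z) (hV₀ : IsOpen V₀)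
    (hKV : closure Z ∩ X ⊆ V₀) {df : Euc n → Euc n →L[ℝ] ℝ} {a : ℝ} (ha : 0 ≤ a)
    (hdf : ContinuousOn df V₀)
    (hslope : ∀ x ∈ V₀, ∀ τ ∈ coneFiber 𝒩 x \ {0}, df x τ + a * ‖τ‖ < 0)
    (hO : NOpen V₀ (slopeCone V₀ df a) O) (hO' : NOpen V₀ (slopeCone V₀ df a) O') :
    NLens X 𝒩 (Z ∩ (O' \ O)) := by
  obtain ⟨⟨hZX, hspec⟩, hcomp, W, f, hW, hKW, hWX, hf⟩ := hZ
  have hsub : closure (Z ∩ (O' \ O)) ∩ X ⊆ closure Z ∩ X :=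
    inter_subset_inter_left _ (closure_mono inter_subset_left)
  refine ⟨⟨inter_subset_left.trans hZX, fun x hx => ?_⟩, ?_,
    W, f, hW, hsub.trans hKW, hWX, hf⟩
  · obtain ⟨V, 𝒩', hV, hxV, hVX, h𝒩', hlt, U₁, U₂, hU₁, hU₂, hZV⟩ := hspec x (hsub hx)
    have hfib : ∀ y ∈ V, coneFiber (coneRestrict 𝒩 V) y = coneFiber 𝒩 y := fun y hy =>
      Set.ext fun v => ⟨fun h => h.1, fun h => ⟨h, hy, trivial⟩⟩
    have hsubV : V ∩ V₀ ⊆ V := inter_subset_left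
    have hsubV₀ : V ∩ V₀ ⊆ V₀ := inter_subset_right
    have hopen : IsOpen (V ∩ V₀) := hV.inter hV₀
    refine ⟨V ∩ V₀, 𝒩' ∩ slopeCone V₀ df a, hopen, ⟨hxV, hKV (hsub hx)⟩,
      hsubV.trans hVX, isConeFam_inter_slopeCone hV hV₀ ha hdf h𝒩' fun y hy => ?_,
      fun y hy v hv => ?_, _, _,
      (hU₁.restrict hsubV hopen inter_subset_left).inter
        (hO'.restrict hsubV₀ hopen inter_subset_right),
      (hU₂.restrict hsubV hopen inter_subset_left).union
        (hO.restrict hsubV₀ hopen inter_subset_right), ?_⟩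
    · obtain ⟨w, hw, hw0⟩ := (h𝒩.cone y (hVX hy.1)).exists_ne_zero
      have hw' : w ∈ coneFiber 𝒩 y \ {0} := ⟨interior_subset hw, hw0⟩
      refine ⟨w, hlt y hy.1 ?_, hslope y hy.2 w hw'⟩
      rwa [hfib y hy.1]
    · have hv' : v ∈ coneFiber 𝒩 y \ {0} := ⟨hv.1.1, hv.2⟩
      change v ∈ interior (coneFiber 𝒩' y ∩ coneFiber (slopeCone V₀ df a) y)
      rw [interior_inter]
      refine ⟨hlt y hy.1 ?_, mem_interior_slopeCone hy.2 (hslope y hy.2 v hv')⟩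
      rwa [hfib y hy.1]
    · ext y
      have h := Set.ext_iff.1 hZV y
      simp only [mem_inter_iff, mem_sdiff, mem_union] at h ⊢
      tauto
  · have : closure (Z ∩ (O' \ O)) ∩ X = closure Z ∩ X ∩ closure (Z ∩ (O' \ O)) := by
      ext y
      exact ⟨fun hy => ⟨hsub hy, hy.1⟩, fun hy => ⟨hy.2, hy.1.2⟩⟩
    rw [this]
    exact hcomp.inter_right isClosed_closure

/-- an `𝒩`-lens admits an `𝒩`-special partition subordinate to any
open cover of its closure in `X`. -/
theorem stmt_17 {n : ℕ} (X : Set (Euc n)) (hX : IsOpen X)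
    (𝒩 : Set (Euc n × Euc n)) (h𝒩 : IsConeFam X 𝒩)
    (Z : Set (Euc n)) (hZ : NLens X 𝒩 Z)
    (𝒰 : Set (Set (Euc n))) (h𝒰o : ∀ U ∈ 𝒰, IsOpen U) (h𝒰X : ∀ U ∈ 𝒰, U ⊆ X)
    (hcov : closure Z ∩ X ⊆ ⋃₀ 𝒰) :
    ∃ Ps : Set (Set (Euc n)), NSpecialPartition X 𝒩 Z Ps ∧
      ∀ A ∈ Ps, ∃ U ∈ 𝒰, A ⊆ U := by
  rcases Z.eq_empty_or_nonempty with rfl | ⟨x₀, hx₀⟩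
  · obtain ⟨Ps, hP, hF, hA⟩ := exists_partition_of_open_filtration (S := (∅ : Set (Euc n)))
      (M := 0) (O := fun _ => ∅) rfl subset_rfl monotone_const fun _ => isOpen_empty
    exact ⟨Ps, ⟨hP, hF, fun A hAP => absurd (hA A hAP).2 (by simp)⟩,
      fun A hAP => absurd (hA A hAP).2 (by simp)⟩
  rcases subsingleton_or_nontrivial (Euc n) with hE | hE
  · obtain ⟨Ps, hP, hF, hA⟩ := exists_partition_of_open_filtration (S := Z) (M := 1)
      (O := fun i => if i = 0 then ∅ else univ) rfl (by simp)
      (monotone_nat_of_le_succ fun i => by simp) (fun i => by split_ifs <;> simp)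
    have hAZ : ∀ A ∈ Ps, A = Z := by
      intro A hAP
      obtain ⟨-, i, hi, rfl⟩ := hA A hAP
      obtain rfl : i = 0 := by omega
      simp
    refine ⟨Ps, ⟨hP, hF, fun A hAP => hAZ A hAP ▸ hZ⟩, fun A hAP => ?_⟩
    obtain ⟨x, hx⟩ := (hA A hAP).1
    rw [hAZ A hAP] at hx
    obtain ⟨U, hU, hxU⟩ := hcov ⟨subset_closure hx, hZ.1.1 hx⟩
    exact ⟨U, hU, fun y _ => Subsingleton.elim x y ▸ hxU⟩
  have hZ' := hZ
  obtain ⟨⟨hZX, -⟩, hcomp, W, f, hW, hKW, hWX, df, hdf, hfd, hneg⟩ := hZ'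
  set K := closure Z ∩ X
  have hZK : Z ⊆ K := fun x hx => ⟨subset_closure hx, hZX hx⟩
  obtain ⟨K', hK', hKK', hK'W⟩ := exists_compact_between hcomp hW hKW
  obtain ⟨a, ha, hslope⟩ := exists_uniform_slope h𝒩 hWX hK' hK'W hdf hneg
  set V₀ := interior K'
  have hV₀ : IsOpen V₀ := isOpen_interior
  have hV₀K' : V₀ ⊆ K' := interior_subset
  have hV₀W : V₀ ⊆ W := hV₀K'.trans hK'W
  obtain ⟨R, hR, hdist⟩ : ∃ R > 0, ∀ x ∈ K', ∀ y ∈ K', ‖x - y‖ ≤ R := by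
    refine ⟨Metric.diam K' + 1, by positivity, fun x hx y hy => ?_⟩
    have := Metric.dist_le_diam_of_mem hK'.isBounded hx hy
    rw [dist_eq_norm] at this
    linarith
  obtain ⟨δ, hδ, hleb⟩ := lebesgue_number_lemma_of_metric_sUnion hcomp h𝒰o hcov
  obtain ⟨ε, hε, hεR⟩ : ∃ ε > 0, ε * (2 * R) ≤ a :=
    ⟨a / (2 * R), by positivity, by rw [div_mul_cancel₀ _ (by positivity)]⟩
  obtain ⟨k, p, hpK, hp⟩ : ∃ (k : ℕ) (p : ℕ → Euc n), (∀ i, p i ∈ K) ∧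
      ∀ x ∈ K, ∃ i < k, ‖x - p i‖ < δ / 2 := by
    obtain ⟨t, htK, htfin, ht⟩ := hcomp.finite_cover_balls (half_pos hδ)
    obtain ⟨k, q, -, rfl⟩ := htfin.fin_param
    refine ⟨k, fun i => if h : i < k then q ⟨i, h⟩ else x₀, fun i => ?_, fun x hx => ?_⟩
    · dsimp only
      split_ifs with h
      · exact htK (mem_range_self _)
      · exact hZK hx₀
    · obtain ⟨-, ⟨i, rfl⟩, hi⟩ := mem_iUnion₂.1 (ht hx)
      refine ⟨i, i.2, ?_⟩
      simpa [dist_eq_norm] using hi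
  set η := ε * δ ^ 2 / 2 with hη
  have hηpos : 0 < η := by positivity
  have hfc : ContinuousOn f K := fun x hx => (hfd x (hKW hx)).continuousAt.continuousWithinAt
  obtain ⟨A, hA⟩ := (hcomp.image_of_continuousOn hfc).bddBelow
  obtain ⟨B, hB⟩ := (hcomp.image_of_continuousOn hfc).bddAbove
  obtain ⟨J, hJ⟩ := exists_nat_gt ((B - A) / η)
  rw [div_lt_iff₀ hηpos] at hJ
  -- Sublevel sets of `f + ε ‖· - p‖²` restricted to a thin slab of `f` are small.
  let T : ℕ → Set (Euc n) := fun m =>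
    V₀ ∩ {x | f x + ε * ‖x - p (m % k)‖ ^ 2 < A + ((m / k : ℕ) : ℝ) * η + 2 * η}
  let O : ℕ → Set (Euc n) := fun m => ⋃ (i : ℕ) (_ : i < m), T i
  have hT : ∀ m, NOpen V₀ (slopeCone V₀ df a) (T m) := by
    intro m
    refine nOpen_sublevel hV₀
      (df := fun x => df x + ε • (2 • (innerSL ℝ (x - p (m % k))).comp (.id ℝ (Euc n))))
      (fun x hx => ?_) (fun x hx τ hτ => ?_) _
    · exact (hfd x (hV₀W hx)).add (((hasFDerivAt_id x).sub_const _).norm_sq.const_mul ε)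
    · have h1 : df x τ + a * ‖τ‖ ≤ 0 := hτ.2
      have h2 := real_inner_le_norm (x - p (m % k)) τ
      have h3 : ‖x - p (m % k)‖ ≤ R := hdist x (hV₀K' hx) _ (hV₀K' (hKK' (hpK _)))
      have h4 := mul_le_mul_of_nonneg_right h3 (norm_nonneg τ)
      have h5 := mul_le_mul_of_nonneg_right hεR (norm_nonneg τ)
      have h6 := mul_le_mul_of_nonneg_left (h2.trans h4) hε.le
      rw [inner_sub_left] at h6
      simp
      linarith
  have hO : ∀ m, NOpen V₀ (slopeCone V₀ df a) (O m) := fun m =>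
    NOpen.iUnion fun i => NOpen.iUnion fun _ => hT i
  have hOmono : Monotone O := fun i j hij =>
    biUnion_subset_biUnion_left fun l (hl : l < i) => hl.trans_le hij
  have hlevel : ∀ (j : ℕ), ∀ x ∈ K, f x < A + (j + 1) * η → x ∈ O (k * (j + 1)) := by
    intro j x hx hfx
    obtain ⟨i, hi, hxi⟩ := hp x hx
    refine mem_iUnion₂.2 ⟨i + k * j, by rw [mul_add]; omega, hKK' hx, ?_⟩
    have hmod : (i + k * j) % k = i := by rw [Nat.add_mul_mod_self_left, Nat.mod_eq_of_lt hi]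
    have hdiv : (i + k * j) / k = j := by
      rw [Nat.add_mul_div_left _ _ (by omega), Nat.div_eq_of_lt hi, zero_add]
    have hsq : ‖x - p i‖ ^ 2 ≤ (δ / 2) ^ 2 := by gcongr
    have := mul_le_mul_of_nonneg_left hsq hε.le
    have hpos : 0 < ε * δ ^ 2 := by positivity
    simp only [mem_ofPred_eq, hmod, hdiv]
    linarith
  have hM : Z ⊆ O (k * (J + 1)) := by
    intro x hx
    refine hlevel J x (hZK hx) ?_
    have := hB (mem_image_of_mem f (hZK hx))
    linarith
  obtain ⟨Ps, hP, hF, hPs⟩ := exists_partition_of_open_filtration (S := Z)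
    (M := k * (J + 1)) (O := O) (by simp [O]) hM hOmono (fun i => (hO i).2.1)
  refine ⟨Ps, ⟨hP, hF, fun S hS => ?_⟩, fun S hS => ?_⟩
  · obtain ⟨-, m, -, rfl⟩ := hPs S hS
    exact hZ.inter_diff h𝒩 hV₀ hKK' ha.le (hdf.mono hV₀W)
      (fun x hx => hslope x (hV₀K' hx)) (hO m) (hO (m + 1))
  · obtain ⟨-, m, -, rfl⟩ := hPs S hS
    obtain ⟨U, hU, hball⟩ := hleb (p (m % k)) (hpK _)
    refine ⟨U, hU, fun x hx => hball ?_⟩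
    obtain ⟨hxZ, hx1, hx2⟩ := hx
    have hxT : x ∈ T m := by
      obtain ⟨i, hi, hxi⟩ := mem_iUnion₂.1 hx1
      obtain hlt | rfl := Nat.lt_succ_iff_lt_or_eq.1 hi
      · exact absurd (mem_iUnion₂.2 ⟨i, hlt, hxi⟩) hx2
      · exact hxi
    have hlow : A + ((m / k : ℕ) : ℝ) * η ≤ f x := by
      by_contra! hcon
      rcases hj : m / k with _ | j
      · have := hA (mem_image_of_mem f (hZK hxZ))
        rw [hj] at hcon
        simp only [Nat.cast_zero, zero_mul, add_zero] at hcon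
        linarith
      · rw [hj] at hcon
        refine hx2 (hOmono ?_ (hlevel j x (hZK hxZ) (by exact_mod_cast hcon)))
        exact hj ▸ Nat.mul_div_le m k
    have hlt := hxT.2
    simp only [mem_ofPred_eq] at hlt
    rw [Metric.mem_ball, dist_eq_norm]
    refine lt_of_pow_lt_pow_left₀ 2 hδ.le (lt_of_mul_lt_mul_left ?_ hε.le)
    linarith
end
end
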